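/- Strong-eavesdropper informed-guess value in the bilocality scenario with a Bell-state measurement: with ρ = |Ψ⁻⟩⟨Ψ⁻| ⊗ |Ψ⁻⟩⟨Ψ⁻| (16×16 matrix, ordering A,B₁,B₂,C), one has Σ_{b=1}^{4} max_{a,c∈{0,1}} Tr[ρ·(Π⁰_a ⊗ P_b ⊗ Π⁰_c)] = 3/8. (This is the guessing probability of an eavesdropper who projects Bob's qubits onto the Bell basis and then makes an informed guess of Alice's and Charlie's outcomes conditioned on the Bell outcome; it corresponds to at most log₂(8/3) ≈ 1.41 certifiable bits.) -/

import Mathlib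

open Matrix Kronecker

noncomputable section

abbrev M2 := Matrix (Fin 2) (Fin 2) ℂ
abbrev M4 := Matrix (Fin 2 × Fin 2) (Fin 2 × Fin 2) ℂ
abbrev Quad := Fin 2 × Fin 2 × Fin 2 × Fin 2
abbrev M16 := Matrix Quad Quad ℂ

/-- Pauli Z matrix. -/
def σz : M2 := !![1, 0; 0, -1]
/-- Pauli X matrix. -/
def σx : M2 := !![0, 1; 1, 0]

/-- The complex number 1/√2. -/
def invSqrt2 : ℂ := ((Real.sqrt 2 : ℝ) : ℂ)⁻¹

/-- Bell state Φ⁺ = (|00⟩+|11⟩)/√2. -/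
def PhiP : Fin 2 × Fin 2 → ℂ := fun p =>
  if p = (0, 0) then invSqrt2 else if p = (1, 1) then invSqrt2 else 0
/-- Bell state Φ⁻ = (|00⟩−|11⟩)/√2. -/
def PhiM : Fin 2 × Fin 2 → ℂ := fun p =>
  if p = (0, 0) then invSqrt2 else if p = (1, 1) then -invSqrt2 else 0
/-- Bell state Ψ⁺ = (|01⟩+|10⟩)/√2. -/
def PsiP : Fin 2 × Fin 2 → ℂ := fun p =>
  if p = (0, 1) then invSqrt2 else if p = (1, 0) then invSqrt2 else 0
/-- Bell state Ψ⁻ = (|01⟩−|10⟩)/√2. -/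
def PsiM : Fin 2 × Fin 2 → ℂ := fun p =>
  if p = (0, 1) then invSqrt2 else if p = (1, 0) then -invSqrt2 else 0

/-- Rank-one projector |ψ⟩⟨ψ|. -/
def proj {n : Type*} (ψ : n → ℂ) : Matrix n n ℂ := vecMulVec ψ (star ψ)

/-- The four Bell states, ordered Φ⁺, Φ⁻, Ψ⁺, Ψ⁻. -/
def Bell : Fin 4 → (Fin 2 × Fin 2 → ℂ) := ![PhiP, PhiM, PsiP, PsiM]

/-- Projectors onto the Bell states. -/
def P (b : Fin 4) : M4 := proj (Bell b)

/-- Kronecker product M_A ⊗ M_{B₁B₂} ⊗ M_C, in the tensor ordering A, B₁, B₂, C. -/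
def kron3 (MA : M2) (MB : M4) (MC : M2) : M16 := fun p q =>
  MA p.1 q.1 * MB (p.2.1, p.2.2.1) (q.2.1, q.2.2.1) * MC p.2.2.2 q.2.2.2

/-- The two-singlet state vector |Ψ⁻⟩_{AB₁} ⊗ |Ψ⁻⟩_{B₂C}. -/
def twoSinglets : Quad → ℂ := fun p => PsiM (p.1, p.2.1) * PsiM (p.2.2.1, p.2.2.2)

/-- The density matrix ρ = |Ψ⁻⟩⟨Ψ⁻| ⊗ |Ψ⁻⟩⟨Ψ⁻| on A, B₁, B₂, C. -/
def ρ₂ : M16 := proj twoSinglets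

/-- Spectral projectors Πˣ_a = ½(I₂ + (−1)^a (σz + (−1)^x σx)/√2) of the
observables (σz ± σx)/√2. -/
def Proj (x a : Fin 2) : M2 :=
  (1 / 2 : ℂ) • ((1 : M2) + (((-1 : ℂ) ^ (a : ℕ)) * invSqrt2) • (σz + ((-1 : ℂ) ^ (x : ℕ)) • σx))

/-- Eigenprojectors Qʸ_s = ½(I₄ + (−1)^s σ⊗σ) of σz⊗σz (y = 0) and σx⊗σx (y = 1);
s = 0 is the "+" projector and s = 1 the "−" projector. -/
def Q (y s : Fin 2) : M4 :=
  (1 / 2 : ℂ) • ((1 : M4) + ((-1 : ℂ) ^ (s : ℕ)) • (if y = 0 then σz ⊗ₖ σz else σx ⊗ₖ σx))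

/-- Correlator ⟨ψ|(A ⊗ C)|ψ⟩ of two single-qubit observables on a two-qubit state. -/
def corr (ψ : Fin 2 × Fin 2 → ℂ) (A C : M2) : ℂ := star ψ ⬝ᵥ ((A ⊗ₖ C) *ᵥ ψ)
lemma inv_sq : invSqrt2 * invSqrt2 = 1 / 2 := by
  unfold invSqrt2
  rw [← mul_inv, ← Complex.ofReal_mul, Real.mul_self_sqrt (by norm_num)]
  norm_num

lemma inv_star : (starRingEnd ℂ) invSqrt2 = invSqrt2 := by
  unfold invSqrt2
  rw [map_inv₀, Complex.conj_ofReal]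

lemma PsiM_vals : PsiM (0,0) = 0 ∧ PsiM (0,1) = invSqrt2 ∧ PsiM (1,0) = -invSqrt2 ∧
    PsiM (1,1) = 0 := by
  simp [PsiM]

lemma tr_form (A C : M2) (v : Fin 2 × Fin 2 → ℂ) :
    trace (ρ₂ * kron3 A (proj v) C) =
      (1 / 4) * ∑ i : Fin 2, ∑ j : Fin 2, ∑ k : Fin 2, ∑ l : Fin 2,
        (-1 : ℂ) ^ ((i : ℕ) + j + k + l) * A i j * C k l *
          (v (1 - i, 1 - k) * star (v (1 - j, 1 - l))) := by
  obtain ⟨h1, h2, h3, h4⟩ := PsiM_vals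
  have h := inv_sq
  have h4' : invSqrt2 ^ 4 = 1 / 4 := by
    rw [show invSqrt2 ^ 4 = (invSqrt2 * invSqrt2) * (invSqrt2 * invSqrt2) by ring, h]; norm_num
  simp only [trace, diag, mul_apply, ρ₂, kron3, proj, vecMulVec_apply, twoSinglets,
    Fintype.sum_prod_type, Fin.sum_univ_two, Pi.star_apply, h1, h2, h3, h4, star_mul', star_neg,
    star_zero, RCLike.star_def, map_neg, map_zero, inv_star, mul_zero, zero_mul, add_zero, zero_add]
  simp only [Fin.val_zero, Fin.val_one, sub_zero, sub_self, show ((1:Fin 2) - 0) = 1 from rfl]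
  ring_nf
  simp only [h4']
  ring

def EE : Fin 4 → ℝ := ![1, 0, 0, -1]

set_option maxHeartbeats 4000000 in
lemma tr_val (a c : Fin 2) (b : Fin 4) :
    (trace (ρ₂ * kron3 (Proj 0 a) (P b) (Proj 0 c))).re
      = (1 + (-1 : ℝ) ^ ((a : ℕ) + c) * EE b) / 16 := by
  have h := inv_sq
  have h2' : invSqrt2 ^ 2 = 1 / 2 := by rw [pow_two, h]
  have h4' : invSqrt2 ^ 4 = 1 / 4 := by
    rw [show invSqrt2 ^ 4 = (invSqrt2 ^ 2) ^ 2 by ring, h2']; norm_num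
  have h3' : invSqrt2 ^ 3 = invSqrt2 / 2 := by
    rw [show invSqrt2 ^ 3 = (invSqrt2 ^ 2) * invSqrt2 by ring, h2']; ring
  have key : trace (ρ₂ * kron3 (Proj 0 a) (P b) (Proj 0 c))
      = (((1 + (-1 : ℝ) ^ ((a : ℕ) + c) * EE b) / 16 : ℝ) : ℂ) := by
    rw [P, tr_form]
    fin_cases b <;> fin_cases a <;> fin_cases c <;>
    · simp [Bell, PhiP, PhiM, PsiP, PsiM, Proj, σz, σx, EE, Fin.sum_univ_two, inv_star]
      try ring_nf
      try simp only [h2', h3', h4']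
      try ring_nf
  rw [key, Complex.ofReal_re]

lemma sup2 (f : Fin 2 → ℝ) : (⨆ a, f a) = max (f 0) (f 1) := by
  apply le_antisymm
  · apply ciSup_le
    intro a
    fin_cases a <;> simp
  · have hb : BddAbove (Set.range f) := (Set.finite_range f).bddAbove
    exact max_le (le_ciSup hb 0) (le_ciSup hb 1)

/-- Strong-eavesdropper informed-guess value with a Bell-state measurement:
Σ_b max_{a,c} Tr[ρ·(Π⁰_a ⊗ P_b ⊗ Π⁰_c)] = 3/8. -/
theorem informed_guess_AC_BSM :
    ∑ b : Fin 4, (⨆ a : Fin 2, ⨆ c : Fin 2,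
      (trace (ρ₂ * kron3 (Proj 0 a) (P b) (Proj 0 c))).re) = 3 / 8 := by
  simp only [tr_val, sup2, Fin.sum_univ_four]
  simp [EE]
  norm_num
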